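/- Let β ∈ [0,1] and let f ∈ 𝒜_β with logarithmic inverse coefficients Γ_1 and Γ_2. Then |Γ_2| − |Γ_1| ≤ 1/(3−2β) for 0 ≤ β < 1, while |Γ_2| − |Γ_1| ≤ (−1 + 5β − 3β²)/((2−β)²(3−2β)) for β = 1; moreover |Γ_2| − |Γ_1| ≥ −1/√(3(3−2β)) for all β ∈ [0,1]. All the inequalities are sharp. -/

import Mathlib

open Metric Filter Set

/-- The class `𝒜_β`: analytic `f(z) = z + ∑_{n≥2} aₙ zⁿ` on the unit disk with
`Re (β f(z)/z + (1-β) f'(z)) > 0`. -/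
def IsAbeta (β : ℝ) (a : ℕ → ℂ) (f : ℂ → ℂ) : Prop :=
  a 0 = 0 ∧ a 1 = 1 ∧
  (∀ z ∈ Metric.ball (0 : ℂ) 1, HasSum (fun n => a n * z ^ n) (f z)) ∧
  ∀ z ∈ Metric.ball (0 : ℂ) 1, z ≠ 0 →
    0 < ((β : ℂ) * f z / z + (1 - (β : ℂ)) * deriv f z).re

/-- The **Schwarz–Pick inequality** at the origin. -/
lemma norm_deriv_zero_le_one_sub_sq {φ : ℂ → ℂ} (hd : DifferentiableOn ℂ φ (ball 0 1))
    (hb : ∀ z ∈ ball (0 : ℂ) 1, ‖φ z‖ ≤ 1) : ‖deriv φ 0‖ ≤ 1 - ‖φ 0‖ ^ 2 := by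
  have h0 : (0 : ℂ) ∈ ball (0 : ℂ) 1 := by simp
  have hn : ball (0 : ℂ) 1 ∈ nhds (0 : ℂ) := isOpen_ball.mem_nhds h0
  rcases (hb 0 h0).lt_or_eq with hlt | heq
  · set c := φ 0 with hc
    have hsq : ‖c‖ ^ 2 < 1 := by nlinarith [norm_nonneg c]
    have hden : ∀ z ∈ ball (0 : ℂ) 1, 1 - (starRingEnd ℂ) c * φ z ≠ 0 := by
      intro z hz h
      have h1 : ‖(starRingEnd ℂ) c * φ z‖ = 1 := by rw [← sub_eq_zero.mp h]; simp
      rw [norm_mul, Complex.norm_conj] at h1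
      nlinarith [hb z hz, norm_nonneg c, norm_nonneg (φ z)]
    have hψd : DifferentiableOn ℂ (fun z => (φ z - c) / (1 - (starRingEnd ℂ) c * φ z))
        (ball 0 1) :=
      (hd.sub_const c).div ((differentiableOn_const 1).sub (hd.const_mul _)) hden
    have hψb : ∀ z ∈ ball (0 : ℂ) 1, ‖(φ z - c) / (1 - (starRingEnd ℂ) c * φ z)‖ ≤ 1 := by
      intro z hz
      rw [norm_div, div_le_one (norm_pos_iff.mpr (hden z hz))]
      refine le_of_sq_le_sq ?_ (norm_nonneg _)
      have hz1 : ‖φ z‖ ^ 2 ≤ 1 := by nlinarith [hb z hz, norm_nonneg (φ z)]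
      have key : ‖1 - (starRingEnd ℂ) c * φ z‖ ^ 2 - ‖φ z - c‖ ^ 2
          = (1 - ‖c‖ ^ 2) * (1 - ‖φ z‖ ^ 2) := by
        simp only [Complex.sq_norm, Complex.normSq_apply, Complex.sub_re, Complex.sub_im,
          Complex.mul_re, Complex.mul_im, Complex.conj_re, Complex.conj_im, Complex.one_re,
          Complex.one_im]
        ring
      nlinarith [mul_nonneg (sub_nonneg.mpr hsq.le) (sub_nonneg.mpr hz1)]
    have hS := Complex.norm_deriv_le_one_of_mapsTo_ball hψd
      (fun z hz => by simpa [← hc] using hψb z hz) one_pos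
    have hφ : HasDerivAt φ (deriv φ 0) 0 := (hd.differentiableAt hn).hasDerivAt
    have hcc : (1 : ℂ) - (starRingEnd ℂ) c * c = ((1 - ‖c‖ ^ 2 : ℝ) : ℂ) := by
      rw [mul_comm, Complex.mul_conj, Complex.normSq_eq_norm_sq]; push_cast; ring
    have hder := ((hφ.sub_const c).div ((hφ.const_mul ((starRingEnd ℂ) c)).const_sub 1)
      (hden 0 h0)).deriv
    have hpos : 0 < 1 - ‖c‖ ^ 2 := by linarith
    have hval : deriv (fun z => (φ z - c) / (1 - (starRingEnd ℂ) c * φ z)) 0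
        = deriv φ 0 / ((1 - ‖c‖ ^ 2 : ℝ) : ℂ) := by
      refine Eq.trans hder ?_
      have := hden 0 h0
      rw [← hc] at this ⊢
      rw [← hcc]
      field_simp
      ring
    rw [hval, norm_div, Complex.norm_real, Real.norm_of_nonneg hpos.le, div_le_one hpos] at hS
    exact hS
  · have hmax : IsLocalMax (norm ∘ φ) 0 := by
      filter_upwards [hn] with z hz
      simpa [heq] using hb z hz
    have hdiff : ∀ᶠ z in nhds (0 : ℂ), DifferentiableAt ℂ φ z := by
      filter_upwards [hn] with z hz using hd.differentiableAt (isOpen_ball.mem_nhds hz)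
    have hev : φ =ᶠ[nhds 0] fun _ => φ 0 :=
      Complex.eventually_eq_of_isLocalMax_norm hdiff hmax
    rw [hev.deriv_eq, heq]
    simp

/-- The second-coefficient inequality for functions `1 + p z + H(0) z² + ⋯` of positive real part. -/
lemma norm_sub_half_sq_le_of_re_pos {p : ℂ} {H : ℂ → ℂ} (hH : DifferentiableOn ℂ H (ball 0 1))
    (hpos : ∀ z ∈ ball (0 : ℂ) 1, 0 < (1 + p * z + z ^ 2 * H z).re) :
    ‖p‖ ≤ 2 ∧ ‖H 0 - p ^ 2 / 2‖ ≤ 2 - ‖p‖ ^ 2 / 2 := by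
  have h0 : (0 : ℂ) ∈ ball (0 : ℂ) 1 := by simp
  have hn : ball (0 : ℂ) 1 ∈ nhds (0 : ℂ) := isOpen_ball.mem_nhds h0
  have hden : ∀ z ∈ ball (0 : ℂ) 1, 2 + p * z + z ^ 2 * H z ≠ 0 := by
    intro z hz h
    have := hpos z hz
    rw [show 1 + p * z + z ^ 2 * H z = (2 + p * z + z ^ 2 * H z) - 1 by ring, h] at this
    norm_num at this
  have hφd : DifferentiableOn ℂ (fun z => (p + z * H z) / (2 + p * z + z ^ 2 * H z))
      (ball 0 1) := by
    refine DifferentiableOn.div ?_ ?_ hden <;> fun_prop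
  set φ := fun z => (p + z * H z) / (2 + p * z + z ^ 2 * H z) with hφ
  have hωd : DifferentiableOn ℂ (fun z => z * φ z) (ball 0 1) := differentiableOn_id.mul hφd
  have hωb : MapsTo (fun z => z * φ z) (ball 0 1) (closedBall ((0 : ℂ) * φ 0) 1) := by
    intro z hz
    have hP := hpos z hz
    have e1 : z * φ z = ((1 + p * z + z ^ 2 * H z) - 1) / ((1 + p * z + z ^ 2 * H z) + 1) := by
      simp only [hφ]
      rw [show (1 + p * z + z ^ 2 * H z) + 1 = 2 + p * z + z ^ 2 * H z by ring]
      ring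
    have hne := hden z hz
    rw [show 2 + p * z + z ^ 2 * H z = (1 + p * z + z ^ 2 * H z) + 1 by ring] at hne
    simp only [zero_mul, mem_closedBall, dist_zero_right]
    rw [e1, norm_div, div_le_one (norm_pos_iff.mpr hne)]
    refine le_of_sq_le_sq ?_ (norm_nonneg _)
    generalize 1 + p * z + z ^ 2 * H z = P at hP
    simp only [Complex.sq_norm, Complex.normSq_apply, Complex.sub_re, Complex.sub_im,
      Complex.add_re, Complex.add_im, Complex.one_re, Complex.one_im]
    nlinarith
  have hφ0 : φ 0 = p / 2 := by simp [hφ]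
  have hφb : ∀ z ∈ ball (0 : ℂ) 1, ‖φ z‖ ≤ 1 := by
    intro z hz
    rcases eq_or_ne z 0 with rfl | hz0
    · have h1 := Complex.norm_deriv_le_one_of_mapsTo_ball hωd hωb one_pos
      have h2 : HasDerivAt (fun z => z * φ z) (1 * φ 0 + 0 * deriv φ 0) 0 :=
        (hasDerivAt_id (0 : ℂ)).mul (hφd.differentiableAt hn).hasDerivAt
      rw [h2.deriv] at h1
      simpa using h1
    · have h1 := Complex.norm_le_norm_of_mapsTo_ball hωd (by simpa using hωb) (by simp)
        (mem_ball_zero_iff.mp hz)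
      rw [norm_mul] at h1
      exact le_of_mul_le_mul_left (by simpa using h1) (norm_pos_iff.mpr hz0)
  have hSP := norm_deriv_zero_le_one_sub_sq hφd hφb
  have hHd : HasDerivAt H (deriv H 0) 0 := (hH.differentiableAt hn).hasDerivAt
  have hid := hasDerivAt_id (0 : ℂ)
  have hder := (((hid.mul hHd).const_add p).div
    (((hid.const_mul p).const_add 2).add ((hid.pow 2).mul hHd)) (by simp)).deriv
  have hval : deriv φ 0 = (H 0 - p ^ 2 / 2) / 2 := by
    refine Eq.trans hder ?_
    simp
    ring
  have hφn : ‖φ 0‖ = ‖p‖ / 2 := by rw [hφ0, norm_div]; simp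
  rw [hval, norm_div, hφn] at hSP
  have hb0 := hφb 0 h0
  rw [hφn] at hb0
  norm_num at hSP
  constructor <;> linarith

/-- A function summed on the unit disk by the power series `∑ aₙ zⁿ` has that expansion in
Mathlib's sense. -/
lemma hasFPowerSeriesOnBall_of_hasSum {a : ℕ → ℂ} {f : ℂ → ℂ}
    (hf : ∀ z ∈ ball (0 : ℂ) 1, HasSum (fun n => a n * z ^ n) (f z)) :
    HasFPowerSeriesOnBall f (.ofScalars ℂ a) 0 1 := by
  constructor
  · refine le_of_forall_lt_imp_le_of_dense fun r hr ↦ ?_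
    lift r to NNReal using hr.ne_top
    apply FormalMultilinearSeries.le_radius_of_summable
    simpa using (hf r (by simpa using hr)).summable.norm
  · simp
  · intro y hy
    rw [← ENNReal.coe_one, Metric.eball_coe, NNReal.coe_one] at hy
    simpa [mul_comm] using hf y hy

lemma differentiableOn_of_hasSum {a : ℕ → ℂ} {f : ℂ → ℂ}
    (hf : ∀ z ∈ ball (0 : ℂ) 1, HasSum (fun n => a n * z ^ n) (f z)) :
    DifferentiableOn ℂ f (ball 0 1) := by
  have h := (hasFPowerSeriesOnBall_of_hasSum hf).differentiableOn
  rwa [← ENNReal.coe_one, Metric.eball_coe, NNReal.coe_one] at h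

/-- Termwise differentiation of a power series on the unit disk. -/
lemma hasSum_deriv_of_hasSum {a : ℕ → ℂ} {f : ℂ → ℂ}
    (hf : ∀ z ∈ ball (0 : ℂ) 1, HasSum (fun n => a n * z ^ n) (f z))
    {z : ℂ} (hz : z ∈ ball (0 : ℂ) 1) :
    HasSum (fun n => a n * (n * z ^ (n - 1))) (deriv f z) := by
  obtain ⟨r, hzr, hr1⟩ := exists_between (mem_ball_zero_iff.mp hz)
  have hr0 : 0 ≤ r := (norm_nonneg z).trans hzr.le
  have hsum := (hf (r : ℂ) (by simpa [abs_of_nonneg hr0] using hr1)).summable.norm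
  have hzr' : z ∈ ball (0 : ℂ) r := by simpa using hzr
  have h := Complex.hasSum_deriv_of_summable_norm (F := fun n w => a n * w ^ n) hsum
    (fun n => by fun_prop) isOpen_ball (fun n w hw => by
      have hw' : ‖w‖ ≤ r := (mem_ball_zero_iff.mp hw).le
      simp only [norm_mul, norm_pow, Complex.norm_real, Real.norm_of_nonneg hr0]
      gcongr) hzr'
  have hev : (fun w => ∑' n, a n * w ^ n) =ᶠ[nhds z] f := by
    filter_upwards [isOpen_ball.mem_nhds hz] with w hw using (hf w hw).tsum_eq
  rw [hev.deriv_eq] at h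
  simpa using h

/-- `f(z) = z + a₂ z² + z³ g(z)` with `g` holomorphic on the disk and `g(0) = a₃`. -/
lemma exists_cubic_remainder {a : ℕ → ℂ} {f : ℂ → ℂ} (ha0 : a 0 = 0) (ha1 : a 1 = 1)
    (hf : ∀ z ∈ ball (0 : ℂ) 1, HasSum (fun n => a n * z ^ n) (f z)) :
    ∃ g : ℂ → ℂ, DifferentiableOn ℂ g (ball 0 1) ∧ g 0 = a 3 ∧
      ∀ z, f z = z + a 2 * z ^ 2 + z ^ 3 * g z := by
  have hn : ball (0 : ℂ) 1 ∈ nhds (0 : ℂ) := isOpen_ball.mem_nhds (by simp)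
  have hp := (hasFPowerSeriesOnBall_of_hasSum hf).hasFPowerSeriesAt
  set D : ℂ → ℂ := dslope (dslope (dslope f 0) 0) 0
  have hval (k : ℕ) : (Function.swap dslope 0)^[k] f 0 = a k := by
    rw [← (hp.has_fpower_series_iterate_dslope_fslope k).coeff_zero 1,
      ← FormalMultilinearSeries.coeff, FormalMultilinearSeries.coeff_iterate_fslope]
    simp
  have v0 : f 0 = a 0 := hval 0
  have v1 : dslope f 0 0 = a 1 := hval 1
  have v2 : dslope (dslope f 0) 0 0 = a 2 := hval 2
  have step (F : ℂ → ℂ) (z : ℂ) : F z = F 0 + z * dslope F 0 z := by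
    have := sub_smul_dslope F 0 z
    simp only [sub_zero, smul_eq_mul] at this
    rw [this]; ring
  refine ⟨D, ?_, hval 3, fun z => ?_⟩
  · simp only [D, Complex.differentiableOn_dslope hn]
    exact differentiableOn_of_hasSum hf
  · rw [step f z, step (dslope f 0) z, step (dslope (dslope f 0) 0) z, v0, v1, v2, ha0, ha1]
    ring

/-- The coefficient region of the initial coefficients for the class `𝒜_β`. -/
lemma IsAbeta.coeff_bounds {β : ℝ} {a : ℕ → ℂ} {f : ℂ → ℂ} (hf : IsAbeta β a f) :
    ‖((2 - β : ℝ) : ℂ) * a 2‖ ≤ 2 ∧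
      ‖((3 - 2 * β : ℝ) : ℂ) * a 3 - (((2 - β : ℝ) : ℂ) * a 2) ^ 2 / 2‖
        ≤ 2 - ‖((2 - β : ℝ) : ℂ) * a 2‖ ^ 2 / 2 := by
  obtain ⟨ha0, ha1, hs, hpos⟩ := hf
  obtain ⟨g, hg, hg0, hfg⟩ := exists_cubic_remainder ha0 ha1 hs
  have hg' : DifferentiableOn ℂ (deriv g) (ball 0 1) := hg.deriv isOpen_ball
  have key := norm_sub_half_sq_le_of_re_pos (p := ((2 - β : ℝ) : ℂ) * a 2)
    (H := fun z => ((3 - 2 * β : ℝ) : ℂ) * g z + ((1 - β : ℝ) : ℂ) * (z * deriv g z))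
    ((hg.const_mul _).add ((differentiableOn_id.mul hg').const_mul _)) ?_
  · simpa [hg0] using key
  · intro z hz
    rcases eq_or_ne z 0 with rfl | hz0
    · simp
    · have hgd : HasDerivAt g (deriv g z) z :=
        (hg.differentiableAt (isOpen_ball.mem_nhds hz)).hasDerivAt
      have hid := hasDerivAt_id z
      have hd := ((hid.add ((hid.pow 2).const_mul (a 2))).add ((hid.pow 3).mul hgd)).deriv
      have hd' : deriv f z = 1 + a 2 * (2 * z) + (3 * z ^ 2 * g z + z ^ 3 * deriv g z) := by
        rw [show f = fun z => z + a 2 * z ^ 2 + z ^ 3 * g z from funext hfg]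
        refine Eq.trans hd ?_
        simp
      have h := hpos z hz hz0
      rw [hd', hfg z] at h
      convert h using 2
      push_cast
      field_simp
      ring

/-- Coefficients of the extremal functions, for which `β f(z)/z + (1-β) f'(z)` is the convex
combination `(1+t)/2 · (1+z)/(1-z) + (1-t)/2 · (1-z)/(1+z)`. -/
noncomputable def extremalCoeff (β t : ℝ) (n : ℕ) : ℂ :=
  if n = 0 then 0 else if n = 1 then 1 else
    ((1 + t) - (1 - t) * (-1) ^ n) / (β + (1 - β) * n)

lemma re_inv_one_sub_gt_half {z : ℂ} (hz : ‖z‖ < 1) : 1 / 2 < ((1 - z)⁻¹).re := by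
  have hne : 1 - z ≠ 0 := fun h => by
    rw [← sub_eq_zero.mp h] at hz; simp at hz
  have h1 : 0 < Complex.normSq (1 - z) := Complex.normSq_pos.mpr hne
  rw [Complex.inv_re, lt_div_iff₀ h1]
  have h2 : ‖z‖ ^ 2 < 1 := by nlinarith [norm_nonneg z]
  rw [Complex.sq_norm, Complex.normSq_apply] at h2
  simp only [Complex.normSq_apply, Complex.sub_re, Complex.sub_im, Complex.one_re, Complex.one_im]
  nlinarith

lemma exists_isAbeta_extremalCoeff {β t : ℝ} (hβ : β ∈ Set.Icc (0 : ℝ) 1)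
    (ht : t ∈ Set.Icc (0 : ℝ) 1) : ∃ g, IsAbeta β (extremalCoeff β t) g := by
  obtain ⟨hβ0, hβ1⟩ := hβ
  obtain ⟨ht0, ht1⟩ := ht
  have hden (n : ℕ) (hn : n ≠ 0) : 1 ≤ β + (1 - β) * n := by
    have : (1 : ℝ) ≤ n := by exact_mod_cast Nat.one_le_iff_ne_zero.mpr hn
    nlinarith
  have hbound (n : ℕ) : ‖extremalCoeff β t n‖ ≤ 2 := by
    unfold extremalCoeff
    split_ifs with h0 h1
    · simp
    · simp
    · have e : ((β : ℂ) + (1 - β) * n) = ((β + (1 - β) * n : ℝ) : ℂ) := by push_cast; rfl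
      have e2 : ((1 : ℂ) + t - (1 - t) * (-1) ^ n) = ((1 + t - (1 - t) * (-1) ^ n : ℝ) : ℂ) := by
        push_cast; rfl
      have hd := hden n h0
      rw [e, e2, norm_div, Complex.norm_real, Complex.norm_real,
        Real.norm_of_nonneg (by linarith : 0 ≤ β + (1 - β) * n), div_le_iff₀ (by linarith)]
      refine le_trans ?_ (by linarith : (2 : ℝ) ≤ 2 * (β + (1 - β) * n))
      rw [Real.norm_eq_abs, abs_le]
      rcases neg_one_pow_eq_or ℝ n with h | h <;> rw [h] <;> constructor <;> linarith
  have hs : ∀ z ∈ ball (0 : ℂ) 1, HasSum (fun n => extremalCoeff β t n * z ^ n)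
      (∑' n, extremalCoeff β t n * z ^ n) := by
    intro z hz
    refine Summable.hasSum (Summable.of_norm_bounded
      ((summable_geometric_of_lt_one (norm_nonneg z) (mem_ball_zero_iff.mp hz)).mul_left 2) ?_)
    intro n
    rw [norm_mul, norm_pow]
    gcongr
    exact hbound n
  refine ⟨_, by simp [extremalCoeff], by simp [extremalCoeff], hs, fun z hz hz0 => ?_⟩
  have hz1 := mem_ball_zero_iff.mp hz
  have hz2 : ‖-z‖ < 1 := by simpa using hz1
  have hL := ((hs z hz).mul_left ((β : ℂ) / z)).add
    ((hasSum_deriv_of_hasSum hs hz).mul_left (1 - (β : ℂ)))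
  rw [← hasSum_nat_add_iff' 1] at hL
  have hR := ((hasSum_geometric_of_norm_lt_one hz1).mul_left ((1 : ℂ) + t)).add
    ((hasSum_geometric_of_norm_lt_one hz2).mul_left ((1 : ℂ) - t))
  have hR' := hR.sub (hasSum_ite_eq (0 : ℕ) (1 : ℂ))
  have heq := hL.unique (hR'.congr_fun ?_)
  · have h1 := re_inv_one_sub_gt_half hz1
    have h2 := re_inv_one_sub_gt_half hz2
    have hr (s : ℝ) (w : ℂ) : (((s : ℝ) : ℂ) * w).re = s * w.re := Complex.re_ofReal_mul s w
    have h0 : extremalCoeff β t 0 = 0 := by simp [extremalCoeff]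
    simp only [Finset.range_one, Finset.sum_singleton, h0, zero_mul, mul_zero, add_zero,
      sub_zero] at heq
    rw [mul_div_right_comm, heq, ← Complex.ofReal_one, ← Complex.ofReal_add,
      ← Complex.ofReal_sub, Complex.sub_re, Complex.add_re, hr, hr, Complex.ofReal_re]
    push_cast
    nlinarith
  · intro n
    rcases Nat.eq_zero_or_pos n with rfl | hn
    · simp [extremalCoeff, hz0]
    · have hd : ((β : ℂ) + (1 - β) * (n + 1)) ≠ 0 := by
        have h := hden (n + 1) (by omega)
        have e : ((β : ℂ) + (1 - β) * (n + 1))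
            = ((β + (1 - β) * ((n + 1 : ℕ) : ℝ) : ℝ) : ℂ) := by push_cast; rfl
        rw [e]
        exact_mod_cast (by linarith : β + (1 - β) * ((n + 1 : ℕ) : ℝ) ≠ 0)
      have hn0 : n ≠ 0 := by omega
      simp only [extremalCoeff, hn0, Nat.add_eq_zero_iff, Nat.add_eq_right, and_false,
        if_false, one_ne_zero, Nat.add_sub_cancel, sub_zero]
      rw [neg_pow z]
      push_cast
      field_simp
      ring

lemma extremalCoeff_two (β t : ℝ) : extremalCoeff β t 2 = ((2 * t / (2 - β) : ℝ) : ℂ) := by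
  simp only [extremalCoeff]
  norm_num
  ring_nf

lemma extremalCoeff_three (β t : ℝ) : extremalCoeff β t 3 = ((2 / (3 - 2 * β) : ℝ) : ℂ) := by
  simp only [extremalCoeff]
  norm_num
  ring_nf

lemma extremalCoeff_functional (β t : ℝ) :
    ‖-(1 / 2 : ℂ) * (extremalCoeff β t 3 - (3 / 2 : ℂ) * (extremalCoeff β t 2) ^ 2)‖
      - ‖-(extremalCoeff β t 2) / 2‖
    = |1 / (3 - 2 * β) - 3 * t ^ 2 / (2 - β) ^ 2| - |t / (2 - β)| := by
  rw [extremalCoeff_two, extremalCoeff_three]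
  congr 1
  · rw [← abs_neg, ← Real.norm_eq_abs, ← Complex.norm_real]
    congr 1
    push_cast
    rw [div_pow]
    ring
  · rw [← abs_neg, ← Real.norm_eq_abs, ← Complex.norm_real]
    congr 1
    push_cast
    ring

/-- Two-sided bound for `|Γ₂|` in terms of `|a₂|`. -/
lemma IsAbeta.logInverse_bounds {β : ℝ} (hβ : β ∈ Set.Icc (0 : ℝ) 1) {a : ℕ → ℂ} {f : ℂ → ℂ}
    (hf : IsAbeta β a f) :
    (2 - β) * ‖a 2‖ ≤ 2 ∧
    2 * (3 - 2 * β) * ‖-(1 / 2 : ℂ) * (a 3 - (3 / 2 : ℂ) * (a 2) ^ 2)‖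
      ≤ 2 + (3 * (3 - 2 * β) / 2 - (2 - β) ^ 2) * ‖a 2‖ ^ 2 ∧
    3 * (3 - 2 * β) / 2 * ‖a 2‖ ^ 2 - 2
      ≤ 2 * (3 - 2 * β) * ‖-(1 / 2 : ℂ) * (a 3 - (3 / 2 : ℂ) * (a 2) ^ 2)‖ := by
  obtain ⟨hβ0, hβ1⟩ := hβ
  have hm : 0 ≤ 2 - β := by linarith
  have hk : 0 ≤ 2 * (3 - 2 * β) := by linarith
  have hq : 0 ≤ (3 * (3 - 2 * β) - (2 - β) ^ 2) / 2 := by nlinarith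
  obtain ⟨h1, h2⟩ := hf.coeff_bounds
  rw [norm_mul, Complex.norm_real, Real.norm_of_nonneg hm] at h1 h2
  set E := ((3 - 2 * β : ℝ) : ℂ) * a 3 - (((2 - β : ℝ) : ℂ) * a 2) ^ 2 / 2 with hE
  set Q := (((3 * (3 - 2 * β) - (2 - β) ^ 2) / 2 : ℝ) : ℂ) * a 2 ^ 2 with hQ
  have hΓ : 2 * (3 - 2 * β) * ‖-(1 / 2 : ℂ) * (a 3 - (3 / 2 : ℂ) * (a 2) ^ 2)‖ = ‖Q - E‖ := by
    nth_rewrite 1 [← Real.norm_of_nonneg hk]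
    rw [← Complex.norm_real, ← norm_mul, hQ, hE]
    congr 1
    push_cast
    ring
  have hQn : ‖Q‖ = (3 * (3 - 2 * β) - (2 - β) ^ 2) / 2 * ‖a 2‖ ^ 2 := by
    rw [hQ, norm_mul, norm_pow, Complex.norm_real, Real.norm_of_nonneg hq]
  have h3 := norm_sub_le Q E
  have h4 := norm_sub_norm_le Q E
  rw [hΓ]
  exact ⟨h1, by nlinarith, by nlinarith⟩

theorem stmt8 (β : ℝ) (hβ : β ∈ Set.Icc (0 : ℝ) 1)
    (a : ℕ → ℂ) (f : ℂ → ℂ) (hf : IsAbeta β a f) :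
    -- with `Γ₁ = -a₂/2` and `Γ₂ = -(1/2)(a₃ - (3/2)a₂²)`
    (β < 1 → ‖-(1 / 2 : ℂ) * (a 3 - (3 / 2 : ℂ) * (a 2) ^ 2)‖ - ‖-(a 2) / 2‖
      ≤ 1 / (3 - 2 * β)) ∧
    (β = 1 → ‖-(1 / 2 : ℂ) * (a 3 - (3 / 2 : ℂ) * (a 2) ^ 2)‖ - ‖-(a 2) / 2‖
      ≤ (-1 + 5 * β - 3 * β ^ 2) / ((2 - β) ^ 2 * (3 - 2 * β))) ∧
    (-(1 / Real.sqrt (3 * (3 - 2 * β)))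
      ≤ ‖-(1 / 2 : ℂ) * (a 3 - (3 / 2 : ℂ) * (a 2) ^ 2)‖ - ‖-(a 2) / 2‖) ∧
    -- sharpness of each bound
    (β < 1 → ∃ b g, IsAbeta β b g ∧
      ‖-(1 / 2 : ℂ) * (b 3 - (3 / 2 : ℂ) * (b 2) ^ 2)‖ - ‖-(b 2) / 2‖
        = 1 / (3 - 2 * β)) ∧
    (β = 1 → ∃ b g, IsAbeta β b g ∧
      ‖-(1 / 2 : ℂ) * (b 3 - (3 / 2 : ℂ) * (b 2) ^ 2)‖ - ‖-(b 2) / 2‖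
        = (-1 + 5 * β - 3 * β ^ 2) / ((2 - β) ^ 2 * (3 - 2 * β))) ∧
    (∃ b g, IsAbeta β b g ∧
      ‖-(1 / 2 : ℂ) * (b 3 - (3 / 2 : ℂ) * (b 2) ^ 2)‖ - ‖-(b 2) / 2‖
        = -(1 / Real.sqrt (3 * (3 - 2 * β)))) := by
  have hβ0 : 0 ≤ β := hβ.1
  have hβ1 : β ≤ 1 := hβ.2
  have hk : 0 < 3 - 2 * β := by linarith
  have hm : 0 < 2 - β := by linarith
  have hnorm : ‖-(a 2) / 2‖ = ‖a 2‖ / 2 := by simp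
  obtain ⟨hx2, hup, hlow⟩ := hf.logInverse_bounds hβ
  have hx : 0 ≤ ‖a 2‖ := norm_nonneg _
  have upper : ‖-(1 / 2 : ℂ) * (a 3 - (3 / 2 : ℂ) * (a 2) ^ 2)‖ - ‖-(a 2) / 2‖
      ≤ 1 / (3 - 2 * β) := by
    rw [hnorm, le_div_iff₀ hk]
    have h1 : (3 * (3 - 2 * β) / 2 - (2 - β) ^ 2) * 2 ≤ (3 - 2 * β) * (2 - β) := by
      nlinarith [mul_nonneg (by linarith : 0 ≤ 5 - 4 * β) (by linarith : 0 ≤ 1 - β)]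
    have h2 : (3 * (3 - 2 * β) / 2 - (2 - β) ^ 2) * 2 * ‖a 2‖ ≤ (3 - 2 * β) * 2 := by
      calc _ ≤ (3 - 2 * β) * (2 - β) * ‖a 2‖ := by gcongr
        _ = (3 - 2 * β) * ((2 - β) * ‖a 2‖) := by ring
        _ ≤ _ := by gcongr
    nlinarith [mul_le_mul_of_nonneg_right h2 hx]
  have hend : β = 1 → (-1 + 5 * β - 3 * β ^ 2) / ((2 - β) ^ 2 * (3 - 2 * β))
      = 1 / (3 - 2 * β) := by
    rintro rfl
    norm_num
  have attained : ∃ b g, IsAbeta β b g ∧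
      ‖-(1 / 2 : ℂ) * (b 3 - (3 / 2 : ℂ) * (b 2) ^ 2)‖ - ‖-(b 2) / 2‖ = 1 / (3 - 2 * β) := by
    obtain ⟨g, hg⟩ := exists_isAbeta_extremalCoeff (t := 0) hβ (by simp)
    refine ⟨_, g, hg, ?_⟩
    rw [extremalCoeff_functional]
    simp [abs_of_pos hk]
  have hs0 : 0 < Real.sqrt (3 * (3 - 2 * β)) := Real.sqrt_pos.mpr (by linarith)
  have hy0 : 0 < 1 / Real.sqrt (3 * (3 - 2 * β)) := by positivity
  have hy2 : (1 / Real.sqrt (3 * (3 - 2 * β))) ^ 2 * (3 * (3 - 2 * β)) = 1 := by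
    rw [div_pow, Real.sq_sqrt (by linarith)]
    field_simp
  set y := 1 / Real.sqrt (3 * (3 - 2 * β)) with hy
  refine ⟨fun _ => upper, fun h => (hend h).symm ▸ upper, ?_, fun _ => attained,
    fun h => (hend h).symm ▸ attained, ?_⟩
  · rw [hnorm]
    set G := ‖-(1 / 2 : ℂ) * (a 3 - (3 / 2 : ℂ) * (a 2) ^ 2)‖ with hG
    have hG0 : 0 ≤ G := norm_nonneg _
    have hGl : 3 / 4 * ‖a 2‖ ^ 2 - 3 * y ^ 2 ≤ G := by
      refine le_of_mul_le_mul_left ?_ (by linarith : 0 < 2 * (3 - 2 * β))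
      linarith
    have hy3 : 1 / 3 ≤ y := by
      by_contra! h
      have : y ^ 2 < 1 / 9 := by nlinarith
      nlinarith
    rcases le_total ‖a 2‖ (2 * y) with h | h
    · linarith
    · nlinarith [mul_nonneg (sub_nonneg.mpr h)
        (by linarith : 0 ≤ ‖a 2‖ + 2 * y - 2 / 3)]
  · have ht1 : (2 - β) * y ≤ 1 := by
      refine le_of_sq_le_sq ?_ zero_le_one
      have : (2 - β) ^ 2 ≤ 3 * (3 - 2 * β) := by nlinarith
      nlinarith [mul_le_mul_of_nonneg_left this (sq_nonneg y)]
    obtain ⟨g, hg⟩ := exists_isAbeta_extremalCoeff (t := (2 - β) * y) hβ ⟨by positivity, ht1⟩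
    refine ⟨_, g, hg, ?_⟩
    have e1 : (2 - β) * y / (2 - β) = y := by field_simp
    have e2 : 1 / (3 - 2 * β) - 3 * ((2 - β) * y) ^ 2 / (2 - β) ^ 2 = 0 := by
      field_simp
      linarith
    rw [extremalCoeff_functional, e1, e2, abs_of_pos hy0]
    simp
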